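/- Let a be a positive integer, let r be a nonnegative integer with r < a, let n = a + r, and let m be a nonnegative integer with r ≤ m ≤ n. If gcd(a,m) = 1 and gcd(a, m−j) divides n for all j = 1, …, r, then A(1,a;n,m) ∈ ℕ₀[q]. -/

import Mathlib

open Polynomial Finset

/-- `A(b,a;n,m) ∈ ℕ₀[q]`: the polynomial `(1-q^a)·∏_{i=1}^m (1-q^i)·∏_{i=1}^{n-m} (1-q^i)`
divides `(1-q^b)·∏_{i=1}^n (1-q^i)` in `ℤ[q]` and the quotient has nonnegative coefficients. -/
def AIsNatPoly (b a n m : ℕ) : Prop :=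
  ∃ c : Polynomial ℤ,
    ((1 - X ^ b) * ∏ i ∈ range n, (1 - X ^ (i + 1)) : Polynomial ℤ) =
      ((1 - X ^ a) * (∏ i ∈ range m, (1 - X ^ (i + 1))) *
        ∏ i ∈ range (n - m), (1 - X ^ (i + 1))) * c ∧
    ∀ k : ℕ, 0 ≤ c.coeff k

/-- The multisets of `m` natural numbers all at most `k`, that is, the partitions fitting in an
`m × k` box. -/
def boxPartitions : ℕ → ℕ → Finset (Multiset ℕ)
  | 0, _ => {0}
  | m + 1, 0 => (boxPartitions m 0).image (Multiset.cons 0)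
  | m + 1, k + 1 =>
      (boxPartitions m (k + 1)).image (Multiset.cons (k + 1)) ∪ boxPartitions (m + 1) k

theorem mem_boxPartitions {m k : ℕ} {s : Multiset ℕ} :
    s ∈ boxPartitions m k ↔ s.card = m ∧ ∀ x ∈ s, x ≤ k := by
  induction m, k using boxPartitions.induct generalizing s with
  | case1 k => simp +contextual [boxPartitions]
  | case2 m ih =>
    simp only [boxPartitions, mem_image, ih]
    constructor
    · rintro ⟨t, ⟨rfl, h⟩, rfl⟩
      simpa using h
    · rintro ⟨hc, h⟩
      obtain ⟨x, t, rfl⟩ := Multiset.card_pos_iff_exists_mem.1 (by omega : 0 < s.card) |>.imp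
        fun x hx => Multiset.exists_cons_of_mem hx
      obtain rfl : x = 0 := by simpa using h x
      exact ⟨t, ⟨by simpa using hc, fun y hy => h y (Multiset.mem_cons_of_mem hy)⟩, rfl⟩
  | case3 m k ih₁ ih₂ =>
    simp only [boxPartitions, mem_union, mem_image, ih₁, ih₂]
    constructor
    · rintro (⟨t, ⟨rfl, h⟩, rfl⟩ | ⟨hc, h⟩)
      · simpa using h
      · exact ⟨hc, fun x hx => (h x hx).trans k.le_succ⟩
    · rintro ⟨hc, h⟩
      by_cases hk : k + 1 ∈ s
      · obtain ⟨t, rfl⟩ := Multiset.exists_cons_of_mem hk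
        exact .inl ⟨t, ⟨by simpa using hc, fun y hy => h y (Multiset.mem_cons_of_mem hy)⟩, rfl⟩
      · refine .inr ⟨hc, fun x hx => ?_⟩
        have : x ≠ k + 1 := fun e => hk (e ▸ hx)
        have := h x hx
        omega

/-- The Gaussian binomial coefficient `[m + k choose m]_q`, as the generating polynomial of the
partitions in an `m × k` box. -/
noncomputable def gaussianBinomial (m k : ℕ) : ℤ[X] :=
  ∑ s ∈ boxPartitions m k, X ^ s.sum

theorem coeff_gaussianBinomial (m k w : ℕ) :
    (gaussianBinomial m k).coeff w = #{s ∈ boxPartitions m k | s.sum = w} := by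
  simp [gaussianBinomial, coeff_X_pow, Finset.sum_boole, eq_comm]

theorem gaussianBinomial_zero_left (k : ℕ) : gaussianBinomial 0 k = 1 := by
  simp [gaussianBinomial, boxPartitions]

theorem gaussianBinomial_zero_right (m : ℕ) : gaussianBinomial m 0 = 1 := by
  induction m with
  | zero => exact gaussianBinomial_zero_left 0
  | succ m ih =>
    rw [gaussianBinomial, boxPartitions,
      sum_image fun _ _ _ _ h => (Multiset.cons_inj_right 0).1 h]
    simpa [gaussianBinomial] using ih

theorem gaussianBinomial_succ_succ (m k : ℕ) :
    gaussianBinomial (m + 1) (k + 1) =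
      X ^ (k + 1) * gaussianBinomial m (k + 1) + gaussianBinomial (m + 1) k := by
  rw [gaussianBinomial, boxPartitions, sum_union,
    sum_image fun _ _ _ _ h => (Multiset.cons_inj_right (k + 1)).1 h]
  · simp [gaussianBinomial, mul_sum, pow_add]
  · refine disjoint_left.2 fun s hs hs' => ?_
    obtain ⟨t, -, rfl⟩ := mem_image.1 hs
    have := (mem_boxPartitions.1 hs').2 (k + 1) (Multiset.mem_cons_self _ _)
    omega

theorem gaussianBinomial_mul (m k : ℕ) :
    gaussianBinomial m k *
        ((∏ i ∈ range m, (1 - X ^ (i + 1))) * ∏ i ∈ range k, (1 - X ^ (i + 1))) =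
      ∏ i ∈ range (m + k), (1 - X ^ (i + 1)) := by
  induction m generalizing k with
  | zero => simp [gaussianBinomial_zero_left]
  | succ m ihm =>
    induction k with
    | zero => simp [gaussianBinomial_zero_right]
    | succ k ihk =>
      have h := ihm (k + 1)
      rw [gaussianBinomial_succ_succ, show m + 1 + (k + 1) = m + 1 + k + 1 by ring,
        prod_range_succ _ (m + 1 + k)]
      rw [show m + (k + 1) = m + 1 + k by ring] at h
      rw [prod_range_succ _ m] at ihk ⊢
      rw [prod_range_succ _ k] at h ⊢
      linear_combination X ^ (k + 1) * (1 - X ^ (m + 1)) * h + (1 - X ^ (k + 1)) * ihk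

section Unimodality

/-- The product of the variables `X i` with `i` running over a multiset. -/
noncomputable def multisetMonomial (s : Multiset ℕ) : MvPolynomial ℕ ℚ :=
  (s.map MvPolynomial.X).prod

theorem multisetMonomial_cons (i : ℕ) (s : Multiset ℕ) :
    multisetMonomial (i ::ₘ s) = MvPolynomial.X i * multisetMonomial s := by
  simp [multisetMonomial]

theorem linearIndependent_multisetMonomial : LinearIndependent ℚ multisetMonomial := by
  have h : multisetMonomial =
      MvPolynomial.basisMonomials ℕ ℚ ∘ (Multiset.toFinsupp (α := ℕ)) := by
    funext s
    induction s using Multiset.induction with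
    | empty => simp [multisetMonomial]
    | cons i s ih =>
      have hs : Multiset.toFinsupp (i ::ₘ s) = Finsupp.single i 1 + Multiset.toFinsupp s := by
        rw [← Multiset.singleton_add, map_add, Multiset.toFinsupp_singleton]
      rw [multisetMonomial_cons, ih]
      simp [hs, MvPolynomial.X, MvPolynomial.monomial_mul]
  rw [h]
  exact (MvPolynomial.basisMonomials ℕ ℚ).linearIndependent.comp _ Multiset.toFinsupp.injective

/-- The span of the monomials of degree `m` and weight `w` in the variables `X 0, …, X k`. -/
noncomputable def weightSpan (k m : ℕ) (w : ℤ) : Submodule ℚ (MvPolynomial ℕ ℚ) :=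
  Submodule.span ℚ (multisetMonomial '' {s | s ∈ boxPartitions m k ∧ (s.sum : ℤ) = w})

/-- The raising operator of `sl₂` on the symmetric algebra of its `k + 1`-dimensional irreducible
representation. -/
noncomputable def raising (k : ℕ) : Derivation ℚ (MvPolynomial ℕ ℚ) (MvPolynomial ℕ ℚ) :=
  MvPolynomial.mkDerivation ℚ fun i => ((k : ℚ) - i) • MvPolynomial.X (i + 1)

/-- The lowering operator of `sl₂` on the symmetric algebra of an irreducible representation. -/
noncomputable def lowering : Derivation ℚ (MvPolynomial ℕ ℚ) (MvPolynomial ℕ ℚ) :=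
  MvPolynomial.mkDerivation ℚ fun i => (i : ℚ) • MvPolynomial.X (i - 1)

theorem multisetMonomial_mem {k m : ℕ} {w : ℤ} {s : Multiset ℕ} (hs : s ∈ boxPartitions m k)
    (hw : (s.sum : ℤ) = w) : multisetMonomial s ∈ weightSpan k m w :=
  Submodule.subset_span ⟨s, ⟨hs, hw⟩, rfl⟩

theorem X_mul_mem_weightSpan {k m i : ℕ} {w : ℤ} (hi : i ≤ k) {p : MvPolynomial ℕ ℚ}
    (hp : p ∈ weightSpan k m w) : MvPolynomial.X i * p ∈ weightSpan k (m + 1) (w + i) := by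
  induction hp using Submodule.span_induction with
  | mem p hp =>
    obtain ⟨s, ⟨hs, rfl⟩, rfl⟩ := hp
    rw [← multisetMonomial_cons]
    rw [mem_boxPartitions] at hs
    refine multisetMonomial_mem (mem_boxPartitions.2 ?_) (by simp [add_comm])
    simpa [hi, hs.1] using hs.2
  | zero => simp
  | add p q _ _ hp hq => rw [mul_add]; exact add_mem hp hq
  | smul c p _ hp => rw [mul_smul_comm]; exact Submodule.smul_mem _ _ hp

/-- A derivation shifting the weight of each variable by `e` shifts all weights by `e`. -/
theorem derivation_mem_weightSpan {k : ℕ} {e : ℤ}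
    (D : Derivation ℚ (MvPolynomial ℕ ℚ) (MvPolynomial ℕ ℚ))
    (hD : ∀ i ≤ k, ∃ j ≤ k, ∃ c : ℚ, D (MvPolynomial.X i) = c • MvPolynomial.X j ∧
      (c ≠ 0 → (j : ℤ) = i + e))
    {m : ℕ} {w : ℤ} {p : MvPolynomial ℕ ℚ} (hp : p ∈ weightSpan k m w) :
    D p ∈ weightSpan k m (w + e) := by
  induction hp using Submodule.span_induction with
  | mem p hp =>
    obtain ⟨s, ⟨hs, rfl⟩, rfl⟩ := hp
    induction s using Multiset.induction generalizing m with
    | empty => simp [multisetMonomial]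
    | cons i s ih =>
      obtain ⟨rfl, h⟩ := mem_boxPartitions.1 hs
      have hi := h i (Multiset.mem_cons_self i s)
      have hs' : s ∈ boxPartitions s.card k :=
        mem_boxPartitions.2 ⟨rfl, fun x hx => h x (Multiset.mem_cons_of_mem hx)⟩
      obtain ⟨j, hj, c, hc, hij⟩ := hD i hi
      rw [multisetMonomial_cons, Derivation.leibniz, hc, Multiset.card_cons, smul_eq_mul,
        smul_eq_mul]
      refine add_mem ?_ ?_
      · convert X_mul_mem_weightSpan hi (ih hs') using 2
        push_cast [Multiset.sum_cons]
        ring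
      · rcases eq_or_ne c 0 with rfl | hc0
        · simp
        · rw [mul_smul_comm, mul_comm]
          refine Submodule.smul_mem _ _ ?_
          convert X_mul_mem_weightSpan hj (multisetMonomial_mem hs' rfl) using 2
          rw [hij hc0]
          push_cast [Multiset.sum_cons]
          ring
  | zero => simp
  | add p q _ _ hp hq => rw [map_add]; exact add_mem hp hq
  | smul c p _ hp => rw [Derivation.map_smul]; exact Submodule.smul_mem _ _ hp

theorem raising_mem_weightSpan {k m : ℕ} {w : ℤ} {p : MvPolynomial ℕ ℚ}
    (hp : p ∈ weightSpan k m w) : raising k p ∈ weightSpan k m (w + 1) := by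
  refine derivation_mem_weightSpan _ (fun i hi => ?_) hp
  rcases hi.eq_or_lt with rfl | hi
  · exact ⟨i, le_rfl, 0, by simp [raising]⟩
  · exact ⟨i + 1, hi, k - i, by simp [raising]⟩

theorem lowering_mem_weightSpan {k m : ℕ} {w : ℤ} {p : MvPolynomial ℕ ℚ}
    (hp : p ∈ weightSpan k m w) : lowering p ∈ weightSpan k m (w - 1) := by
  refine derivation_mem_weightSpan (e := -1) _ (fun i hi => ?_) hp
  refine ⟨i - 1, by omega, i, by simp [lowering], fun h => ?_⟩
  have : i ≠ 0 := by exact_mod_cast h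
  omega

theorem commutator_X (k i : ℕ) :
    ⁅raising k, lowering⁆ (MvPolynomial.X i) = (2 * i - k : ℚ) • MvPolynomial.X i := by
  rw [Derivation.commutator_apply]
  cases i with
  | zero => simp [raising, lowering]
  | succ i =>
    simp only [raising, lowering, MvPolynomial.mkDerivation_X, Derivation.map_smul, smul_smul,
      ← sub_smul, Nat.add_sub_cancel]
    congr 1
    push_cast
    ring

theorem commutator_apply_of_mem {k m : ℕ} {w : ℤ} {p : MvPolynomial ℕ ℚ}
    (hp : p ∈ weightSpan k m w) :
    ⁅raising k, lowering⁆ p = (2 * w - k * m : ℚ) • p := by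
  induction hp using Submodule.span_induction with
  | mem p hp =>
    obtain ⟨s, ⟨hs, rfl⟩, rfl⟩ := hp
    obtain ⟨rfl, -⟩ := mem_boxPartitions.1 hs
    clear hs
    induction s using Multiset.induction with
    | empty => simp [multisetMonomial]
    | cons i s ih =>
      rw [multisetMonomial_cons, Derivation.leibniz, commutator_X, ih, smul_eq_mul, smul_eq_mul,
        mul_smul_comm, mul_smul_comm, mul_comm (multisetMonomial s), ← add_smul]
      congr 1
      push_cast [Multiset.sum_cons, Multiset.card_cons]
      ring
  | zero => simp
  | add p q _ _ hp hq => rw [map_add, hp, hq, smul_add]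
  | smul c p _ hp => rw [Derivation.map_smul, hp, smul_comm]

theorem lowering_iterate_mem_weightSpan {k m : ℕ} {w : ℤ} {p : MvPolynomial ℕ ℚ}
    (hp : p ∈ weightSpan k m w) (j : ℕ) : lowering^[j] p ∈ weightSpan k m (w - j) := by
  induction j with
  | zero => simpa using hp
  | succ j ih =>
    rw [Function.iterate_succ_apply']
    convert lowering_mem_weightSpan ih using 2
    push_cast
    ring

theorem raising_lowering_iterate {k m : ℕ} {w : ℤ} {p : MvPolynomial ℕ ℚ}
    (hp : p ∈ weightSpan k m w) (h0 : raising k p = 0) (j : ℕ) :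
    raising k (lowering^[j + 1] p) =
      ((j + 1) * (2 * w - k * m - j) : ℚ) • lowering^[j] p := by
  have key : ∀ j : ℕ, raising k (lowering^[j + 1] p) = lowering (raising k (lowering^[j] p)) +
      (2 * (w - j) - k * m : ℚ) • lowering^[j] p := fun j => by
    have := commutator_apply_of_mem (lowering_iterate_mem_weightSpan hp j)
    rw [Derivation.commutator_apply, sub_eq_iff_eq_add'] at this
    rw [Function.iterate_succ_apply', this]
    push_cast
    rfl
  induction j with
  | zero => rw [key]; simp [h0]
  | succ j ih =>
    rw [key, ih, Derivation.map_smul, ← Function.iterate_succ_apply' lowering, ← add_smul]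
    congr 1
    push_cast
    ring

theorem eq_zero_of_raising_eq_zero {k m : ℕ} {w : ℤ} (hw : 2 * w < k * m) {p : MvPolynomial ℕ ℚ}
    (hp : p ∈ weightSpan k m w) (h0 : raising k p = 0) : p = 0 := by
  have hlow : ∀ j : ℕ, lowering^[j] p = 0 → p = 0 := fun j => by
    induction j with
    | zero => exact id
    | succ j ih =>
      intro hj
      have h := raising_lowering_iterate hp h0 j
      rw [hj, map_zero, eq_comm, smul_eq_zero] at h
      refine ih (h.resolve_left (mul_ne_zero (by positivity) ?_))
      have : (2 * w : ℚ) < k * m := by exact_mod_cast hw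
      have : (0 : ℚ) ≤ j := j.cast_nonneg
      linarith
  refine hlow (w.toNat + 1) ?_
  have h := lowering_iterate_mem_weightSpan hp (w.toNat + 1)
  have hempty : {s | s ∈ boxPartitions m k ∧ (s.sum : ℤ) = w - (w.toNat + 1 : ℕ)} = ∅ :=
    Set.eq_empty_of_forall_notMem fun s hs => by
      have := hs.2
      omega
  rw [weightSpan, hempty, Set.image_empty, Submodule.span_empty] at h
  exact h

theorem finrank_weightSpan (k m w : ℕ) :
    Module.finrank ℚ (weightSpan k m w) = #{s ∈ boxPartitions m k | s.sum = w} := by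
  have h : {s | s ∈ boxPartitions m k ∧ (s.sum : ℤ) = w} =
      ({s ∈ boxPartitions m k | s.sum = w} : Finset (Multiset ℕ)) := by
    ext s
    simp [-Nat.cast_multiset_sum]
  rw [weightSpan, h, Set.image_eq_range]
  exact (finrank_span_eq_card
    (linearIndependent_multisetMonomial.comp _ Subtype.val_injective)).trans (Fintype.card_coe _)

theorem coeff_gaussianBinomial_le_succ {m k w : ℕ} (hw : 2 * w < k * m) :
    (gaussianBinomial m k).coeff w ≤ (gaussianBinomial m k).coeff (w + 1) := by
  rw [coeff_gaussianBinomial, coeff_gaussianBinomial, ← finrank_weightSpan, ← finrank_weightSpan]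
  have hfin : Module.Finite ℚ (weightSpan k m (w + 1 : ℕ)) := by
    refine FiniteDimensional.span_of_finite ℚ (Set.Finite.image _ ?_)
    exact (boxPartitions m k).finite_toSet.subset fun s hs => hs.1
  have hmaps : ∀ p ∈ weightSpan k m w,
      (raising k : MvPolynomial ℕ ℚ →ₗ[ℚ] MvPolynomial ℕ ℚ) p ∈ weightSpan k m (w + 1 : ℕ) :=
    fun p hp => by exact_mod_cast raising_mem_weightSpan hp
  refine Nat.cast_le.2 (LinearMap.finrank_le_finrank_of_injective
    (f := LinearMap.restrict _ hmaps) ?_)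
  rw [injective_iff_map_eq_zero]
  rintro ⟨p, hp⟩ h
  exact Subtype.ext (eq_zero_of_raising_eq_zero (by exact_mod_cast hw) hp (congrArg Subtype.val h))

end Unimodality

theorem prod_X_pow_sub_one_eq_prod_cyclotomic {n N : ℕ} (h : n ≤ N) :
    ∏ i ∈ range n, (X ^ (i + 1) - 1 : ℤ[X]) = ∏ d ∈ Icc 1 N, cyclotomic d ℤ ^ (n / d) := by
  induction n with
  | zero => simp
  | succ n ih =>
    rw [prod_range_succ, ih (by omega), ← prod_cyclotomic_eq_X_pow_sub_one n.succ_pos]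
    have : (n + 1).divisors = {d ∈ Icc 1 N | d ∣ n + 1} := by
      ext d
      simp only [Nat.mem_divisors, mem_filter, mem_Icc]
      exact ⟨fun hd => ⟨⟨Nat.pos_of_dvd_of_pos hd.1 n.succ_pos,
        (Nat.le_of_dvd n.succ_pos hd.1).trans h⟩, hd.1⟩, fun hd => ⟨hd.2, n.succ_ne_zero⟩⟩
    rw [Nat.succ_eq_add_one, this, prod_filter, ← prod_mul_distrib]
    refine prod_congr rfl fun d _ => ?_
    rw [Nat.succ_div]
    split_ifs <;> simp [pow_succ]

theorem prod_one_sub_X_pow (n : ℕ) :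
    ∏ i ∈ range n, (1 - X ^ (i + 1) : ℤ[X]) =
      (-1) ^ n * ∏ i ∈ range n, (X ^ (i + 1) - 1 : ℤ[X]) := by
  rw [← card_range n, ← prod_const, card_range, ← prod_mul_distrib]
  exact prod_congr rfl fun _ _ => by ring

theorem gaussianBinomial_eq_prod_cyclotomic (m k : ℕ) :
    gaussianBinomial m k =
      ∏ d ∈ Icc 1 (m + k), cyclotomic d ℤ ^ ((m + k) / d - (m / d + k / d)) := by
  have h := gaussianBinomial_mul m k
  simp only [prod_one_sub_X_pow] at h
  rw [prod_X_pow_sub_one_eq_prod_cyclotomic (Nat.le_add_right m k),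
    prod_X_pow_sub_one_eq_prod_cyclotomic (Nat.le_add_left k m),
    prod_X_pow_sub_one_eq_prod_cyclotomic le_rfl, mul_mul_mul_comm, ← pow_add, mul_left_comm] at h
  replace h := mul_left_cancel₀ (pow_ne_zero _ (by simp)) h
  rw [← prod_mul_distrib] at h
  refine mul_right_cancel₀ (prod_ne_zero_iff.2 fun d _ => ?_) (h.trans ?_)
  · exact mul_ne_zero (pow_ne_zero _ (cyclotomic_ne_zero d ℤ))
      (pow_ne_zero _ (cyclotomic_ne_zero d ℤ))
  · rw [← prod_mul_distrib]
    refine prod_congr rfl fun d _ => ?_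
    rw [← pow_add, ← pow_add, Nat.sub_add_cancel Nat.div_add_div_le_add_div]

theorem one_sub_X_pow_dvd {a m k : ℕ} (ha : 0 < a) (hle : a ≤ m + k)
    (h : ∀ d, d ∣ a → d ≠ 1 → m / d + k / d < (m + k) / d) :
    (1 - X ^ a : ℤ[X]) ∣ (1 - X) * gaussianBinomial m k := by
  have h1 : (X ^ a - 1 : ℤ[X]) ∣ (X - 1) * gaussianBinomial m k := by
    rw [← prod_cyclotomic_eq_X_pow_sub_one ha, ← mul_prod_erase _ _ (Nat.one_mem_divisors.2 ha.ne'),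
      cyclotomic_one, gaussianBinomial_eq_prod_cyclotomic]
    refine mul_dvd_mul_left _ ((prod_dvd_prod_of_dvd _ _ fun d hd => ?_).trans
      (prod_dvd_prod_of_subset _ _ _ fun d hd => ?_))
    · rw [mem_erase, Nat.mem_divisors] at hd
      exact dvd_pow_self _ (Nat.sub_ne_zero_of_lt (h d hd.2.1 hd.1))
    · rw [mem_erase, Nat.mem_divisors] at hd
      exact mem_Icc.2 ⟨Nat.pos_of_dvd_of_pos hd.2.1 ha, (Nat.le_of_dvd ha hd.2.1).trans hle⟩
  rw [← neg_sub (X ^ a), ← neg_sub X 1, neg_mul]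
  exact neg_dvd.2 (dvd_neg.2 h1)

theorem one_sub_X_pow_ne_zero {i : ℕ} (hi : 0 < i) : (1 - X ^ i : ℤ[X]) ≠ 0 := by
  rw [← neg_sub]
  exact neg_ne_zero.2 (X_pow_sub_C_ne_zero hi 1)

theorem natDegree_one_sub_X_pow (i : ℕ) : (1 - X ^ i : ℤ[X]).natDegree = i := by
  rw [← neg_sub, natDegree_neg]
  exact natDegree_X_pow_sub_C

theorem reverse_one_sub_X_pow (i : ℕ) :
    reverse (1 - X ^ i : ℤ[X]) = -(1 - X ^ i) := by
  rw [reverse, natDegree_one_sub_X_pow, reflect_sub, reflect_monomial, revAt_le le_rfl,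
    Nat.sub_self, reflect_one]
  ring

theorem reverse_prod_one_sub_X_pow (n : ℕ) :
    reverse (∏ i ∈ range n, (1 - X ^ (i + 1)) : ℤ[X]) =
      (-1) ^ n * ∏ i ∈ range n, (1 - X ^ (i + 1)) := by
  induction n with
  | zero => simpa using reverse_C (1 : ℤ)
  | succ n ih =>
    rw [prod_range_succ, reverse_mul_of_domain, ih, reverse_one_sub_X_pow]
    ring

theorem prod_one_sub_X_pow_ne_zero (n : ℕ) : ∏ i ∈ range n, (1 - X ^ (i + 1) : ℤ[X]) ≠ 0 :=
  prod_ne_zero_iff.2 fun i _ => one_sub_X_pow_ne_zero i.succ_pos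

theorem reverse_gaussianBinomial (m k : ℕ) :
    reverse (gaussianBinomial m k) = gaussianBinomial m k := by
  have h := congrArg reverse (gaussianBinomial_mul m k)
  rw [reverse_mul_of_domain, reverse_mul_of_domain, reverse_prod_one_sub_X_pow,
    reverse_prod_one_sub_X_pow, reverse_prod_one_sub_X_pow, ← gaussianBinomial_mul, pow_add] at h
  refine mul_right_cancel₀ (mul_ne_zero (mul_ne_zero (pow_ne_zero m (neg_ne_zero.2 one_ne_zero))
    (pow_ne_zero k (neg_ne_zero.2 one_ne_zero))) (mul_ne_zero (prod_one_sub_X_pow_ne_zero m)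
      (prod_one_sub_X_pow_ne_zero k))) ?_
  linear_combination h

theorem gaussianBinomial_ne_zero (m k : ℕ) : gaussianBinomial m k ≠ 0 := by
  intro h
  have := gaussianBinomial_mul m k
  rw [h, zero_mul] at this
  exact prod_one_sub_X_pow_ne_zero _ this.symm

theorem natDegree_gaussianBinomial (m k : ℕ) : (gaussianBinomial m k).natDegree = m * k := by
  have hd : ∀ n, (∏ i ∈ range n, (1 - X ^ (i + 1) : ℤ[X])).natDegree * 2 = (n + 1) * n := by
    intro n
    rw [natDegree_prod _ _ fun i _ => one_sub_X_pow_ne_zero i.succ_pos]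
    simp_rw [natDegree_one_sub_X_pow]
    have := sum_range_id_mul_two (n + 1)
    rwa [sum_range_succ'] at this
  have h := congrArg natDegree (gaussianBinomial_mul m k)
  rw [natDegree_mul (gaussianBinomial_ne_zero m k) (mul_ne_zero (prod_one_sub_X_pow_ne_zero m)
      (prod_one_sub_X_pow_ne_zero k)), natDegree_mul (prod_one_sub_X_pow_ne_zero m)
      (prod_one_sub_X_pow_ne_zero k)] at h
  have hm := hd m
  have hk := hd k
  have hmk := hd (m + k)
  nlinarith

/-- If `1 - X ^ a` divides `(1 - X) * p` for a palindromic unimodal `p`, then the quotient has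
nonnegative coefficients. -/
theorem coeff_nonneg_of_one_sub_X_mul_eq {a : ℕ} (ha : 0 < a) {p c : ℤ[X]} (hp0 : p ≠ 0)
    (hp : reverse p = p) (hzero : 0 ≤ p.coeff 0)
    (hmono : ∀ w, 2 * w < p.natDegree → p.coeff w ≤ p.coeff (w + 1))
    (hc : (1 - X) * p = (1 - X ^ a) * c) (i : ℕ) : 0 ≤ c.coeff i := by
  have hX : (1 - X : ℤ[X]) = 1 - X ^ 1 := by rw [pow_one]
  have hc0 : c ≠ 0 := by
    rintro rfl
    rw [mul_zero, hX] at hc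
    exact mul_ne_zero (one_sub_X_pow_ne_zero one_pos) hp0 hc
  have hdeg : 1 + p.natDegree = a + c.natDegree := by
    have := congrArg natDegree hc
    rwa [hX, natDegree_mul (one_sub_X_pow_ne_zero one_pos) hp0,
      natDegree_mul (one_sub_X_pow_ne_zero ha) hc0, natDegree_one_sub_X_pow,
      natDegree_one_sub_X_pow] at this
  have hrev : reverse c = c := by
    have := congrArg reverse hc
    rw [hX, reverse_mul_of_domain, reverse_mul_of_domain, hp, reverse_one_sub_X_pow,
      reverse_one_sub_X_pow, neg_mul, neg_mul, neg_inj, ← hX, hc] at this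
    exact (mul_left_cancel₀ (one_sub_X_pow_ne_zero ha) this).symm
  have hlow : ∀ i, 2 * i ≤ p.natDegree → 0 ≤ c.coeff i := by
    intro i
    induction i using Nat.strong_induction_on with
    | _ i ih =>
      intro hi
      have hq : 0 ≤ ((1 - X) * p).coeff i := by
        rw [sub_mul, one_mul, coeff_sub]
        cases i with
        | zero => simpa using hzero
        | succ i => simpa using hmono i (by omega)
      rw [hc, sub_mul, one_mul, coeff_sub, coeff_X_pow_mul'] at hq
      split_ifs at hq with h
      · have := ih (i - a) (by omega) (by omega)
        linarith
      · simpa using hq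
  rcases lt_or_ge c.natDegree i with h | h
  · rw [coeff_eq_zero_of_natDegree_lt h]
  · rcases le_or_gt (2 * i) c.natDegree with h2 | h2
    · exact hlow i (by omega)
    · rw [← hrev, coeff_reverse, revAt_le h]
      exact hlow _ (by omega)

theorem add_div_lt_of_dvd {a r m k d : ℕ} (hn : m + k = a + r) (hgcd : Nat.gcd a m = 1)
    (hdiv : ∀ j : ℕ, 1 ≤ j → j ≤ r → Nat.gcd a (m - j) ∣ a + r) (ha : 0 < a) (hd : d ∣ a)
    (hd1 : d ≠ 1) : m / d + k / d < (m + k) / d := by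
  have hd0 : 0 < d := Nat.pos_of_dvd_of_pos hd ha
  have hmod : m % d ≠ 0 := fun h =>
    hd1 (Nat.dvd_one.1 (hgcd ▸ Nat.dvd_gcd hd (Nat.dvd_of_mod_eq_zero h)))
  have hlt : (m + k) % d < m % d := by
    by_contra! hle
    rw [hn] at hle
    have hr : (a + r) % d = r % d := by
      obtain ⟨e, rfl⟩ := hd
      simp
    have hdn : d ∣ a + r := (Nat.dvd_gcd hd (Nat.dvd_sub_mod m)).trans
      (hdiv (m % d) (Nat.pos_of_ne_zero hmod) (hle.trans (hr ▸ Nat.mod_le r d)))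
    rw [Nat.mod_eq_zero_of_dvd hdn] at hle
    omega
  rw [Nat.add_div hd0]
  split_ifs with h
  · omega
  · rw [Nat.add_mod, Nat.mod_eq_of_lt (not_le.1 h)] at hlt
    omega

theorem stmt4 (a r n m : ℕ) (ha : 0 < a) (hra : r < a) (hn : n = a + r)
    (hrm : r ≤ m) (hmn : m ≤ n) (hgcd : Nat.gcd a m = 1)
    (hdiv : ∀ j : ℕ, 1 ≤ j → j ≤ r → Nat.gcd a (m - j) ∣ n) :
    AIsNatPoly 1 a n m := by
  obtain ⟨k, rfl⟩ := Nat.exists_eq_add_of_le hmn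
  obtain ⟨c, hc⟩ := one_sub_X_pow_dvd (m := m) (k := k) ha (by omega) fun d hd hd1 =>
    add_div_lt_of_dvd hn hgcd (hn ▸ hdiv) ha hd hd1
  refine ⟨c, ?_, coeff_nonneg_of_one_sub_X_mul_eq ha (gaussianBinomial_ne_zero m k)
    (reverse_gaussianBinomial m k) ?_ (fun w hw => ?_) hc⟩
  · rw [Nat.add_sub_cancel_left, ← gaussianBinomial_mul, pow_one]
    linear_combination
      ((∏ i ∈ range m, (1 - X ^ (i + 1))) * ∏ i ∈ range k, (1 - X ^ (i + 1))) * hc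
  · rw [coeff_gaussianBinomial]
    positivity
  · rw [natDegree_gaussianBinomial, mul_comm m] at hw
    exact coeff_gaussianBinomial_le_succ hw
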